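/- arXiv:1604.06823 — 6 statements merged into one kernel-verified Lean document; each statement's English description precedes it below -/
import Mathlib

section
/- Let p be a real polynomial in n variables with total degree at least 1 and let μ ∈ ℝ. If p(x) ≥ μ for all x ∈ ℝⁿ, then the homogeneous component of p of degree equal to the total degree of p is nonnegative everywhere, i.e., evaluating the homogeneous component of degree (totalDegree p) of p at any x ∈ ℝⁿ gives a nonnegative value. -/
open MvPolynomial Filter Topology

/-- A homogeneous polynomial of degree `k` scales by `r ^ k` under dilation by `r`. -/
theorem MvPolynomial.IsHomogeneous.eval_smul_point {σ R : Type*} [CommSemiring R]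
    {q : MvPolynomial σ R} {k : ℕ} (hq : q.IsHomogeneous k) (r : R) (x : σ → R) :
    eval (r • x) q = r ^ k * eval x q := by
  rw [eval_eq, eval_eq, Finset.mul_sum]
  refine Finset.sum_congr rfl fun d hd => ?_
  have hdk : ∑ i ∈ d.support, d i = k := by
    rw [← hq (mem_support_iff.mp hd), Finsupp.weight_apply, Finsupp.sum]
    simp
  simp only [Pi.smul_apply, smul_eq_mul, mul_pow, Finset.prod_mul_distrib,
    Finset.prod_pow_eq_pow_sum, hdk]
  ring

/-- Rescaling `p` along the ray through `x` gives a polynomial in the inverse dilation factor. -/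
theorem MvPolynomial.pow_totalDegree_mul_eval_inv_smul {σ K : Type*} [Field K]
    (p : MvPolynomial σ K) (x : σ → K) {s : K} (hs : s ≠ 0) :
    s ^ p.totalDegree * eval (s⁻¹ • x) p =
      ∑ k ∈ Finset.range (p.totalDegree + 1),
        s ^ (p.totalDegree - k) * eval x (homogeneousComponent k p) := by
  conv_lhs => rw [← sum_homogeneousComponent p, map_sum, Finset.mul_sum]
  rw [sum_homogeneousComponent p]
  refine Finset.sum_congr rfl fun k hk => ?_
  have hk' : k ≤ p.totalDegree := Nat.lt_succ_iff.mp (Finset.mem_range.mp hk)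
  rw [(homogeneousComponent_isHomogeneous k p).eval_smul_point, ← mul_assoc, inv_pow,
    ← pow_sub₀ s hs hk']

/-- if a real polynomial `p` in `n` variables with total degree at least 1 is
bounded below by `μ` on all of `ℝⁿ`, then its homogeneous component of top degree is
nonnegative everywhere. -/
theorem top_homogeneousComponent_nonneg (n : ℕ) (p : MvPolynomial (Fin n) ℝ) (μ : ℝ)
    (hdeg : 1 ≤ p.totalDegree)
    (hbd : ∀ x : Fin n → ℝ, μ ≤ MvPolynomial.eval x p) :
    ∀ x : Fin n → ℝ,
      0 ≤ MvPolynomial.eval x (MvPolynomial.homogeneousComponent p.totalDegree p) := by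
  intro x
  let f : ℝ → ℝ := fun s => ∑ k ∈ Finset.range (p.totalDegree + 1),
    s ^ (p.totalDegree - k) * eval x (homogeneousComponent k p)
  have hf : Continuous f := by fun_prop
  have hf0 : f 0 = eval x (homogeneousComponent p.totalDegree p) := by
    simp only [f, Finset.sum_range_succ, Nat.sub_self, pow_zero, one_mul, add_eq_right]
    refine Finset.sum_eq_zero fun k hk => ?_
    rw [zero_pow (Nat.sub_ne_zero_of_lt (Finset.mem_range.mp hk)), zero_mul]
  have hg : Continuous fun s : ℝ => s ^ p.totalDegree * μ := by fun_prop
  have hle : ∀ᶠ s in 𝓝[>] (0 : ℝ), s ^ p.totalDegree * μ ≤ f s := by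
    filter_upwards [self_mem_nhdsWithin] with s hs
    have hs' : 0 < s := hs
    simp only [f, ← pow_totalDegree_mul_eval_inv_smul p x hs'.ne']
    exact mul_le_mul_of_nonneg_left (hbd _) (by positivity)
  have hlim := le_of_tendsto_of_tendsto (hg.continuousAt.tendsto.mono_left nhdsWithin_le_nhds)
    (hf.continuousAt.tendsto.mono_left nhdsWithin_le_nhds) hle
  rwa [hf0, zero_pow (Nat.one_le_iff_ne_zero.mp hdeg), zero_mul] at hlim
end

section
/- Let p be a real polynomial in n variables with total degree at most d. Then, in the extended reals, inf {p(x) : x ∈ ℝⁿ, x ≥ 0 componentwise} = sup {μ ∈ ℝ : the degree-d homogenization of p − μ satisfies (p − μ)^h(y) ≥ 0 for all y ∈ ℝ^{n+1} with y ≥ 0 componentwise}. -/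
/-- The degree-`d` homogenization of a polynomial `p` in the variables `x₁, …, x_n`:
`p^h = ∑_α p_α · x₀^(d - |α|) · x^α`, a polynomial in the `n + 1` variables
`(x₀, x₁, …, x_n)` (variable `0` is the homogenizing variable, variable `i.succ` is `x_i`). -/
noncomputable def homogenize {n : ℕ} (d : ℕ) (p : MvPolynomial (Fin n) ℝ) :
    MvPolynomial (Fin (n + 1)) ℝ :=
  ∑ α ∈ p.support,
    MvPolynomial.C (MvPolynomial.coeff α p) *
      MvPolynomial.X (0 : Fin (n + 1)) ^ (d - ∑ i, α i) *
      ∏ i : Fin n, MvPolynomial.X i.succ ^ α i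

/-- Scaling identity for the homogenization: `q^h(t, t x) = t ^ d * q(x)`. -/
theorem eval_homogenize_cons_smul {n d : ℕ} {q : MvPolynomial (Fin n) ℝ}
    (hq : q.totalDegree ≤ d) (t : ℝ) (x : Fin n → ℝ) :
    MvPolynomial.eval (Fin.cons t (t • x) : Fin (n + 1) → ℝ) (homogenize d q) =
      t ^ d * MvPolynomial.eval x q := by
  rw [MvPolynomial.eval_eq' x q, homogenize, map_sum, Finset.mul_sum]
  refine Finset.sum_congr rfl fun α hα => ?_
  have hα' : ∑ i, α i ≤ d := by
    have h := (MvPolynomial.le_totalDegree hα).trans hq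
    rwa [Finsupp.sum_fintype _ _ fun _ => rfl] at h
  have ht : t ^ d = t ^ (d - ∑ i, α i) * t ^ ∑ i, α i := by
    rw [← pow_add, Nat.sub_add_cancel hα']
  simp only [map_mul, map_pow, map_prod, MvPolynomial.eval_C, MvPolynomial.eval_X, Fin.cons_zero,
    Fin.cons_succ, Pi.smul_apply, smul_eq_mul, mul_pow, Finset.prod_mul_distrib,
    Finset.prod_pow_eq_pow_sum, ht]
  ring

/-- A polynomial is nonnegative on the nonnegative orthant iff its homogenization is. -/
theorem homogenize_nonneg_iff {n d : ℕ} {q : MvPolynomial (Fin n) ℝ} (hq : q.totalDegree ≤ d) :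
    (∀ y : Fin (n + 1) → ℝ, (∀ i, 0 ≤ y i) → 0 ≤ MvPolynomial.eval y (homogenize d q)) ↔
      ∀ x : Fin n → ℝ, (∀ i, 0 ≤ x i) → 0 ≤ MvPolynomial.eval x q := by
  constructor
  · intro h x hx
    have h₁ := h (Fin.cons 1 ((1 : ℝ) • x)) (Fin.cases (by simp) (by simpa using hx))
    rwa [eval_homogenize_cons_smul hq, one_pow, one_mul] at h₁
  · intro h y hy
    have hpos : ∀ t : ℝ, 0 < t →
        0 ≤ MvPolynomial.eval (Fin.cons t (Fin.tail y) : Fin (n + 1) → ℝ) (homogenize d q) := by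
      intro t ht
      have hs := eval_homogenize_cons_smul hq t (t⁻¹ • Fin.tail y)
      rw [smul_inv_smul₀ ht.ne'] at hs
      rw [hs]
      exact mul_nonneg (pow_nonneg ht.le d)
        (h _ fun i => mul_nonneg (inv_nonneg.2 ht.le) (hy i.succ))
    have hcont : Continuous fun t : ℝ =>
        MvPolynomial.eval (Fin.cons t (Fin.tail y) : Fin (n + 1) → ℝ) (homogenize d q) :=
      (MvPolynomial.continuous_eval _).comp
        (continuous_pi (Fin.cases continuous_id fun _ => continuous_const))
    have hclosed : closure (Set.Ioi (0 : ℝ)) ⊆ {t : ℝ |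
        0 ≤ MvPolynomial.eval (Fin.cons t (Fin.tail y) : Fin (n + 1) → ℝ) (homogenize d q)} :=
      closure_minimal hpos (isClosed_le continuous_const hcont)
    rw [closure_Ioi] at hclosed
    simpa using hclosed (hy 0)

/-- for `p` of total degree at most `d`, in the extended reals,
`inf {p(x) : x ∈ ℝⁿ₊} = sup {μ : (p - μ)^h ≥ 0 on ℝ^(n+1)₊}`. -/
theorem inf_orthant_eq_sup_copositive (n d : ℕ)
    (p : MvPolynomial (Fin n) ℝ) (hdeg : p.totalDegree ≤ d) :
    sInf {z : EReal | ∃ x : Fin n → ℝ, (∀ i, 0 ≤ x i) ∧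
        z = ((MvPolynomial.eval x p : ℝ) : EReal)} =
      sSup {z : EReal | ∃ μ : ℝ, z = ((μ : ℝ) : EReal) ∧
        ∀ y : Fin (n + 1) → ℝ, (∀ i, 0 ≤ y i) →
          0 ≤ MvPolynomial.eval y (homogenize d (p - MvPolynomial.C μ))} := by
  have hfeas : ∀ μ : ℝ, (∀ y : Fin (n + 1) → ℝ, (∀ i, 0 ≤ y i) →
      0 ≤ MvPolynomial.eval y (homogenize d (p - MvPolynomial.C μ))) ↔
      ∀ x : Fin n → ℝ, (∀ i, 0 ≤ x i) → μ ≤ MvPolynomial.eval x p := fun μ => by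
    simpa using homogenize_nonneg_iff ((MvPolynomial.totalDegree_sub_C_le p μ).trans hdeg)
  simp only [hfeas]
  apply le_antisymm
  · have hle : ∀ x : Fin n → ℝ, (∀ i, 0 ≤ x i) →
        sInf {z : EReal | ∃ x : Fin n → ℝ, (∀ i, 0 ≤ x i) ∧
          z = ((MvPolynomial.eval x p : ℝ) : EReal)} ≤ (MvPolynomial.eval x p : ℝ) :=
      fun x hx => sInf_le ⟨x, hx, rfl⟩
    generalize sInf {z : EReal | ∃ x : Fin n → ℝ, (∀ i, 0 ≤ x i) ∧
      z = ((MvPolynomial.eval x p : ℝ) : EReal)} = I at hle ⊢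
    induction I with
    | bot => exact bot_le
    | top => exact absurd (hle 0 fun _ => le_rfl) (EReal.coe_lt_top _).not_ge
    | coe μ => exact le_sSup ⟨μ, rfl, fun x hx => EReal.coe_le_coe_iff.1 (hle x hx)⟩
  · refine sSup_le ?_
    rintro _ ⟨μ, rfl, hμ⟩
    refine le_sInf ?_
    rintro _ ⟨x, hx, rfl⟩
    exact EReal.coe_le_coe_iff.2 (hμ x hx)
end

section
/- Let p₀,…,p_m be real polynomials in n variables of total degree at most 2d, and for i = 0,…,m let T_i be a symmetric tensor of dimension n+1 and order 2d representing p_i; let T_e be a symmetric tensor with ⟨T_e, M_{2d}(y)⟩ = (y₀)^{2d} for all y ∈ ℝ^{n+1}. Define in the extended reals: z := inf {p₀(x) : x ∈ ℝⁿ, p_i(x) ≤ 0 for i = 1,…,m}; z_SP := inf {⟨T₀, X⟩ : X ∈ convexHull{M_{2d}(y) : y ∈ ℝ^{n+1}}, ⟨T_i, X⟩ ≤ 0 for i = 1,…,m, ⟨T_e, X⟩ = 1}; z_SD := sup {μ ∈ ℝ : ∃ u ∈ ℝᵐ with u ≥ 0 such that ⟨T₀, M_{2d}(y)⟩ + ∑_{i=1}^m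 u_i ⟨T_i, M_{2d}(y)⟩ − μ (y₀)^{2d} ≥ 0 for all y ∈ ℝ^{n+1}}; z_LD := sup_{u ∈ ℝᵐ, u ≥ 0} inf_{x ∈ ℝⁿ} (p₀(x) + ∑_{i=1}^m u_i p_i(x)). Then z_LD = z_SD and z_SD ≤ z_SP ≤ z. -/
/-- A tensor of dimension `n` and order `d` is symmetric if its entries are invariant under
permutations of its indices. -/
def IsSymmTensor {n d : ℕ} (T : (Fin d → Fin n) → ℝ) : Prop :=
  ∀ (σ : Equiv.Perm (Fin d)) (f : Fin d → Fin n), T (f ∘ σ) = T f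

/-- The tensor inner product `⟨S, T⟩ = ∑ f, S f * T f`. -/
noncomputable def tenIP {n d : ℕ} (S T : (Fin d → Fin n) → ℝ) : ℝ :=
  ∑ f : Fin d → Fin n, S f * T f

/-- `M_d(x)`, the symmetric tensor with entries `M_d(x)(f) = ∏ j, x (f j)`. -/
def tenM (n d : ℕ) (x : Fin n → ℝ) : (Fin d → Fin n) → ℝ := fun f => ∏ j : Fin d, x (f j)

/-- A symmetric tensor `T` of dimension `n + 1` and order `d` represents the polynomial `p`
(of total degree at most `d`) if `⟨T, M_d(y)⟩ = p^h(y)` for all `y ∈ ℝ^(n+1)`. -/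
def Represents {n : ℕ} (d : ℕ) (T : (Fin d → Fin (n + 1)) → ℝ)
    (p : MvPolynomial (Fin n) ℝ) : Prop :=
  ∀ y : Fin (n + 1) → ℝ,
    tenIP T (tenM (n + 1) d y) = MvPolynomial.eval y (homogenize d p)

open MvPolynomial in
/-- Dehomogenizing the homogenization gives back the polynomial. -/
theorem eval_cons_one_homogenize {n : ℕ} (d : ℕ) (p : MvPolynomial (Fin n) ℝ) (x : Fin n → ℝ) :
    eval (Fin.cons 1 x : Fin (n + 1) → ℝ) (homogenize d p) = eval x p := by
  simp [homogenize, eval_eq' x p]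

theorem Represents.tenIP_cons_one {n d : ℕ} {T : (Fin d → Fin (n + 1)) → ℝ}
    {p : MvPolynomial (Fin n) ℝ} (h : Represents d T p) (x : Fin n → ℝ) :
    tenIP T (tenM (n + 1) d (Fin.cons 1 x)) = MvPolynomial.eval x p := by
  rw [h, eval_cons_one_homogenize]

theorem tenM_smul (n d : ℕ) (c : ℝ) (y : Fin n → ℝ) :
    tenM n d (c • y) = c ^ d • tenM n d y := by
  ext f
  simp [tenM, Finset.prod_mul_distrib]

theorem tenIP_add_right {n d : ℕ} (S X Y : (Fin d → Fin n) → ℝ) :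
    tenIP S (X + Y) = tenIP S X + tenIP S Y := by
  simp [tenIP, mul_add, Finset.sum_add_distrib]

theorem tenIP_smul_right {n d : ℕ} (S X : (Fin d → Fin n) → ℝ) (c : ℝ) :
    tenIP S (c • X) = c * tenIP S X := by
  simp [tenIP, Finset.mul_sum, mul_left_comm]

theorem tenIP_add_left {n d : ℕ} (S S' X : (Fin d → Fin n) → ℝ) :
    tenIP (S + S') X = tenIP S X + tenIP S' X := by
  simp [tenIP, add_mul, Finset.sum_add_distrib]

theorem tenIP_sub_left {n d : ℕ} (S S' X : (Fin d → Fin n) → ℝ) :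
    tenIP (S - S') X = tenIP S X - tenIP S' X := by
  simp [tenIP, sub_mul, Finset.sum_sub_distrib]

theorem tenIP_smul_left {n d : ℕ} (S X : (Fin d → Fin n) → ℝ) (c : ℝ) :
    tenIP (c • S) X = c * tenIP S X := by
  simp [tenIP, Finset.mul_sum, mul_assoc]

theorem tenIP_sum_left {n d : ℕ} {ι : Type*} (s : Finset ι) (S : ι → (Fin d → Fin n) → ℝ)
    (X : (Fin d → Fin n) → ℝ) :
    tenIP (∑ i ∈ s, S i) X = ∑ i ∈ s, tenIP (S i) X := by
  simp only [tenIP, Finset.sum_apply, Finset.sum_mul]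
  exact Finset.sum_comm

theorem continuous_tenIP_tenM {n d : ℕ} (S : (Fin d → Fin n) → ℝ) :
    Continuous fun y => tenIP S (tenM n d y) := by
  unfold tenIP tenM
  fun_prop

/-- A form of even degree that is nonnegative on the affine chart `y₀ = 1` is nonnegative. -/
theorem tenIP_tenM_nonneg_of_cons_one {n d : ℕ} (S : (Fin (2 * d) → Fin (n + 1)) → ℝ)
    (h : ∀ x : Fin n → ℝ, 0 ≤ tenIP S (tenM (n + 1) (2 * d) (Fin.cons 1 x)))
    (y : Fin (n + 1) → ℝ) : 0 ≤ tenIP S (tenM (n + 1) (2 * d) y) := by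
  have hchart (t : ℝ) (ht : t ≠ 0) (x : Fin n → ℝ) :
      0 ≤ tenIP S (tenM (n + 1) (2 * d) (Fin.cons t x)) := by
    have hy : (Fin.cons t x : Fin (n + 1) → ℝ) = t • (Fin.cons 1 (t⁻¹ • x) : Fin (n + 1) → ℝ) := by
      ext i
      refine Fin.cases ?_ (fun j => ?_) i <;> simp [ht]
    rw [hy, tenM_smul, tenIP_smul_right]
    exact mul_nonneg (by rw [pow_mul]; positivity) (h _)
  have hclosed : IsClosed {t : ℝ | 0 ≤ tenIP S (tenM (n + 1) (2 * d) (Fin.cons t (Fin.tail y)))} :=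
    isClosed_Ici.preimage ((continuous_tenIP_tenM S).comp
      (continuous_pi fun i => Fin.cases (by simpa using continuous_id')
        (fun j => by simpa using continuous_const) i))
  have hmem := hclosed.closure_subset_iff.2
    (fun t (ht : t ∈ ({0}ᶜ : Set ℝ)) => hchart t ht (Fin.tail y))
    (dense_compl_singleton (0 : ℝ) (y 0))
  simpa [Fin.cons_self_tail] using hmem

theorem tenIP_nonneg_of_mem_convexHull {n d : ℕ} {S X : (Fin d → Fin n) → ℝ}
    {A : Set ((Fin d → Fin n) → ℝ)} (hA : ∀ Y ∈ A, 0 ≤ tenIP S Y) (hX : X ∈ convexHull ℝ A) :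
    0 ≤ tenIP S X := by
  have hlin : IsLinearMap ℝ (tenIP S) := ⟨tenIP_add_right S, fun c Y => tenIP_smul_right S Y c⟩
  exact convexHull_min (t := {Y | 0 ≤ tenIP S Y}) hA (convex_halfSpace_ge hlin 0) hX

/-- with `z`, `z_SP`, `z_SD`, `z_LD` as in the CPSD tensor relaxation of a POP
with free variables, `z_LD = z_SD ≤ z_SP ≤ z` in the extended reals. -/
theorem lagrangian_eq_cpsd_dual_le_cpsd_le_pop (n d m : ℕ)
    (p : Fin (m + 1) → MvPolynomial (Fin n) ℝ)
    (hdeg : ∀ i, (p i).totalDegree ≤ 2 * d)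
    (T : Fin (m + 1) → (Fin (2 * d) → Fin (n + 1)) → ℝ)
    (hTsymm : ∀ i, IsSymmTensor (T i))
    (hTrep : ∀ i, Represents (2 * d) (T i) (p i))
    (Te : (Fin (2 * d) → Fin (n + 1)) → ℝ)
    (hTesymm : IsSymmTensor Te)
    (hTerep : ∀ y : Fin (n + 1) → ℝ, tenIP Te (tenM (n + 1) (2 * d) y) = (y 0) ^ (2 * d))
    (z zSP zSD zLD : EReal)
    (hz : z = sInf {w : EReal | ∃ x : Fin n → ℝ,
      (∀ i : Fin m, MvPolynomial.eval x (p i.succ) ≤ 0) ∧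
      w = ((MvPolynomial.eval x (p 0) : ℝ) : EReal)})
    (hzSP : zSP = sInf {w : EReal | ∃ X : (Fin (2 * d) → Fin (n + 1)) → ℝ,
      X ∈ convexHull ℝ {S : (Fin (2 * d) → Fin (n + 1)) → ℝ |
        ∃ y : Fin (n + 1) → ℝ, S = tenM (n + 1) (2 * d) y} ∧
      (∀ i : Fin m, tenIP (T i.succ) X ≤ 0) ∧
      tenIP Te X = 1 ∧
      w = ((tenIP (T 0) X : ℝ) : EReal)})
    (hzSD : zSD = sSup {w : EReal | ∃ μ : ℝ, w = ((μ : ℝ) : EReal) ∧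
      ∃ u : Fin m → ℝ, (∀ i, 0 ≤ u i) ∧
        ∀ y : Fin (n + 1) → ℝ,
          0 ≤ tenIP (T 0) (tenM (n + 1) (2 * d) y) +
              (∑ i : Fin m, u i * tenIP (T i.succ) (tenM (n + 1) (2 * d) y)) -
              μ * (y 0) ^ (2 * d)})
    (hzLD : zLD = ⨆ (u : Fin m → ℝ) (_ : ∀ i, 0 ≤ u i),
      ⨅ (x : Fin n → ℝ),
        ((MvPolynomial.eval x (p 0) +
          ∑ i : Fin m, u i * MvPolynomial.eval x (p i.succ) : ℝ) : EReal)) :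
    zLD = zSD ∧ zSD ≤ zSP ∧ zSP ≤ z := by
  let S (u : Fin m → ℝ) (μ : ℝ) : (Fin (2 * d) → Fin (n + 1)) → ℝ :=
    T 0 + ∑ i : Fin m, u i • T i.succ - μ • Te
  have hS (u : Fin m → ℝ) (μ : ℝ) (X) : tenIP (S u μ) X =
      tenIP (T 0) X + (∑ i : Fin m, u i * tenIP (T i.succ) X) - μ * tenIP Te X := by
    simp only [S, tenIP_sub_left, tenIP_add_left, tenIP_sum_left, tenIP_smul_left]
  subst hz hzSP hzSD hzLD
  refine ⟨le_antisymm ?_ ?_, ?_, ?_⟩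
  · refine iSup₂_le fun u hu => EReal.ge_of_forall_gt_iff_ge.1 fun μ hμ =>
      le_sSup ⟨μ, rfl, u, hu, fun y => ?_⟩
    rw [← hTerep, ← hS]
    refine tenIP_tenM_nonneg_of_cons_one _ (fun x => ?_) y
    rw [hS, hTerep]
    simp only [(hTrep _).tenIP_cons_one, Fin.cons_zero, one_pow, mul_one, sub_nonneg]
    exact_mod_cast hμ.le.trans (iInf_le _ x)
  · refine sSup_le ?_
    rintro _ ⟨μ, rfl, u, hu, h⟩
    refine le_iSup₂_of_le u hu (le_iInf fun x => ?_)
    have hx := h (Fin.cons 1 x)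
    simp only [(hTrep _).tenIP_cons_one, Fin.cons_zero, one_pow, mul_one, sub_nonneg] at hx
    exact_mod_cast hx
  · refine sSup_le ?_
    rintro _ ⟨μ, rfl, u, hu, h⟩
    refine le_sInf ?_
    rintro _ ⟨X, hX, hfeas, hone, rfl⟩
    have hnonneg : 0 ≤ tenIP (S u μ) X := by
      refine tenIP_nonneg_of_mem_convexHull ?_ hX
      rintro _ ⟨y, rfl⟩
      rw [hS, hTerep]
      exact h y
    rw [hS, hone] at hnonneg
    have hsum : ∑ i : Fin m, u i * tenIP (T i.succ) X ≤ 0 :=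
      Finset.sum_nonpos fun i _ => mul_nonpos_of_nonneg_of_nonpos (hu i) (hfeas i)
    exact EReal.coe_le_coe_iff.2 (by linarith)
  · refine le_sInf ?_
    rintro _ ⟨x, hx, rfl⟩
    refine sInf_le ⟨tenM (n + 1) (2 * d) (Fin.cons 1 x), subset_convexHull ℝ _ ⟨_, rfl⟩,
      fun i => ?_, ?_, ?_⟩
    · rw [(hTrep _).tenIP_cons_one]
      exact hx i
    · simp [hTerep]
    · rw [(hTrep _).tenIP_cons_one]
end

section
/- Let P = {(a,b) : 1 ≤ a ≤ b ≤ n} index pairs of variables and r = |P| = n(n+1)/2. Let p₀ be a real polynomial in n variables with total degree at most 4 all of whose coefficients are nonnegative; let p₁,…,p_{m₀} be homogeneous polynomials of degree 4 in n variables; let q₁,…,q_{m₁} be polynomials in n variables of total degree at most 2; and let d₁,…,d_{m₀} ∈ ℝ. Suppose q₀ is a polynomial of total degree at most 2 in the n+r variables (x, y) with all coefficients nonnegative such that q₀(x, (x_a x_b)_{(a,b)∈P}) = p₀(x) for all x ∈ ℝⁿ, and for each i, h_i is a homogeneous quadratic form in the r variables y such that h_i((x_a x_b)_{(a,b)∈P})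 = p_i(x) for all x ∈ ℝⁿ. Let T_{p₀}, T_{p_i}, T_{q_j}, T_e be symmetric tensors of dimension n+1 and order 4 representing p₀, p_i, q_j and the constant 1 respectively (so ⟨T_e, M₄(y)⟩ = (y₀)⁴), and let Q_{q₀}, Q_{h_i}, Q_{q_j}, Q_e be symmetric (1+n+r)×(1+n+r) matrices representing the quadratics q₀, h_i, q_j and the constant 1 in the variables (x,y) (i.e., for a quadratic p, (z₀, z)ᵀ Q_p (z₀, z) equals the degree-2 homogenization of p at (z₀,z)). Then for every tensor X ∈ convexHull{M₄(w) : w ∈ ℝ^{n+1}, w ≥ 0} with ⟨T_{p_i}, X⟩ ≤ d_i for i = 1,…,m₀, ⟨T_{q_j}, X⟩ ≤ 0 for j = 1,…,m₁, and ⟨T_e, X⟩ = 1, there exists a matrix Z ∈ convexHull{w wᵀ : w ∈ ℝ^{1+n+r}, w ≥ 0} satisfying ⟨Q_{h_i}, Z⟩ ≤ d_i for i = 1,…,m₀, ⟨Q_{q_j}, Z⟩ ≤ 0 for j = 1,…,m₁, ⟨Q_e, Z⟩ = 1, Z_{0, slot(a,b)} ≤ Z_{a, b} for all (a,b) ∈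 P (where slot(a,b) is the coordinate of the additional variable y_{ab} and indices 1,…,n refer to the x-coordinates, index 0 to the homogenizing coordinate), and ⟨Q_{q₀}, Z⟩ ≥ ⟨T_{p₀}, X⟩. Consequently, the supremum of the completely positive matrix program over such Z is at least the supremum of the completely positive tensor program over such X. -/
/-- The degree-`d` homogenization of a polynomial over an arbitrary finite variable set `σ`,
with the fresh homogenizing variable `Sum.inl ()`. -/
noncomputable def homogenizeG {σ : Type*} [Fintype σ] (d : ℕ) (p : MvPolynomial σ ℝ) :
    MvPolynomial (Unit ⊕ σ) ℝ :=
  ∑ α ∈ p.support,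
    MvPolynomial.C (MvPolynomial.coeff α p) *
      MvPolynomial.X (Sum.inl () : Unit ⊕ σ) ^ (d - ∑ i, α i) *
      ∏ i, MvPolynomial.X (Sum.inr i : Unit ⊕ σ) ^ α i

/-- The index set `P = {(a,b) : 1 ≤ a ≤ b ≤ n}` for the additional variables `y_{ab}`. -/
abbrev PairIdx (n : ℕ) : Type := {q : Fin n × Fin n // q.1 ≤ q.2}

/-- Coordinates of `ℝ^(1 + n + r)`: the homogenizing coordinate `0`, the `x`-coordinates
`1, …, n`, and the additional `y`-coordinates indexed by `P`. -/
abbrev QIdx (n : ℕ) : Type := Unit ⊕ (Fin n ⊕ PairIdx n)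

/-- The quadratic form of a matrix: `w ↦ wᵀ Q w`. -/
noncomputable def qform {I : Type*} [Fintype I] (Q : Matrix I I ℝ) (w : I → ℝ) : ℝ :=
  ∑ i, ∑ j, w i * Q i j * w j

/-- The Frobenius inner product of two matrices. -/
noncomputable def frob {I : Type*} [Fintype I] (Q Z : Matrix I I ℝ) : ℝ :=
  ∑ i, ∑ j, Q i j * Z i j

open MvPolynomial in
/-- Off the hyperplane `x₀ = 0`, the homogenization is the rescaled dehomogenization. -/
theorem eval_homogenize_of_ne_zero {n d : ℕ} {p : MvPolynomial (Fin n) ℝ}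
    (hp : p.totalDegree ≤ d) {t : ℝ} (ht : t ≠ 0) (x : Fin n → ℝ) :
    eval (Fin.cons t x : Fin (n + 1) → ℝ) (homogenize d p) =
      t ^ d * eval (fun i => x i / t) p := by
  rw [homogenize, map_sum, eval_eq' (fun i => x i / t) p, Finset.mul_sum]
  refine Finset.sum_congr rfl fun α hα => ?_
  have hα : ∑ i, α i ≤ d := by
    have := le_totalDegree hα
    rw [Finsupp.sum_fintype _ _ fun _ => rfl] at this
    exact this.trans hp
  simp only [map_mul, map_pow, map_prod, eval_C, eval_X, Fin.cons_zero, Fin.cons_succ, div_pow,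
    Finset.prod_div_distrib, Finset.prod_pow_eq_pow_sum]
  rw [pow_sub₀ _ ht hα]
  field_simp

open MvPolynomial in
/-- Off the hyperplane where the fresh variable vanishes, the homogenization is the rescaled
dehomogenization. -/
theorem eval_homogenizeG_of_ne_zero {σ : Type*} [Fintype σ] {d : ℕ} {p : MvPolynomial σ ℝ}
    (hp : p.totalDegree ≤ d) {t : ℝ} (ht : t ≠ 0) (x : σ → ℝ) :
    eval (Sum.elim (fun _ => t) x : Unit ⊕ σ → ℝ) (homogenizeG d p) =
      t ^ d * eval (fun i => x i / t) p := by
  rw [homogenizeG, map_sum, eval_eq' (fun i => x i / t) p, Finset.mul_sum]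
  refine Finset.sum_congr rfl fun α hα => ?_
  have hα : ∑ i, α i ≤ d := by
    have := le_totalDegree hα
    rw [Finsupp.sum_fintype _ _ fun _ => rfl] at this
    exact this.trans hp
  simp only [map_mul, map_pow, map_prod, eval_C, eval_X, Sum.elim_inl, Sum.elim_inr, div_pow,
    Finset.prod_div_distrib, Finset.prod_pow_eq_pow_sum]
  rw [pow_sub₀ _ ht hα]
  field_simp

/-- The two tensor indices whose product of coordinates is the given lifted coordinate:
`w₀ w₀` for the homogenizing coordinate, `w₀ w_a` for `x_a`, and `w_a w_b` for `y_{ab}`. -/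
def liftIdx {n : ℕ} : QIdx n → Fin (n + 1) × Fin (n + 1) :=
  Sum.elim (fun _ => (0, 0)) (Sum.elim (fun a => (0, a.succ)) fun pr => (pr.1.1.succ, pr.1.2.succ))

/-- The lift `w ↦ (w₀², w₀ w_a, w_a w_b)` from `ℝ^(n+1)` to `ℝ^(1+n+r)`. -/
def liftVec {n : ℕ} (w : Fin (n + 1) → ℝ) (i : QIdx n) : ℝ :=
  w (liftIdx i).1 * w (liftIdx i).2

/-- The linear map from order-4 tensors to matrices sending `M₄(w)` to the rank-one matrix of
the lift of `w`. -/
def tensorToMatrix (n : ℕ) :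
    ((Fin 4 → Fin (n + 1)) → ℝ) →ₗ[ℝ] Matrix (QIdx n) (QIdx n) ℝ where
  toFun X := Matrix.of fun i j =>
    X ![(liftIdx i).1, (liftIdx i).2, (liftIdx j).1, (liftIdx j).2]
  map_add' _ _ := rfl
  map_smul' _ _ := rfl

theorem tensorToMatrix_tenM {n : ℕ} (w : Fin (n + 1) → ℝ) :
    tensorToMatrix n (tenM (n + 1) 4 w) = Matrix.of fun i j => liftVec w i * liftVec w j := by
  ext i j
  change tenM (n + 1) 4 w ![_, _, _, _] = _
  simp [tenM, liftVec, Fin.prod_univ_four, mul_assoc]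

open MvPolynomial in
/-- If the quadratic `g` restricts to the quartic `p` under `y_{ab} = x_a x_b`, then so do the
homogenizations under the lift. -/
theorem eval_liftVec_homogenizeG {n : ℕ} {g : MvPolynomial (Fin n ⊕ PairIdx n) ℝ}
    {p : MvPolynomial (Fin n) ℝ} (hg : g.totalDegree ≤ 2) (hp : p.totalDegree ≤ 4)
    (hgp : ∀ x : Fin n → ℝ,
      eval (Sum.elim x (fun pr => x pr.1.1 * x pr.1.2)) g = eval x p)
    (w : Fin (n + 1) → ℝ) :
    eval (liftVec w) (homogenizeG 2 g) = eval w (homogenize 4 p) := by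
  obtain ⟨t, x, rfl⟩ : ∃ t x, w = Fin.cons t x := ⟨w 0, Fin.tail w, (Fin.cons_self_tail w).symm⟩
  have hne : Set.EqOn
      (fun t : ℝ => eval (liftVec (Fin.cons t x : Fin (n + 1) → ℝ)) (homogenizeG 2 g))
      (fun t : ℝ => eval (Fin.cons t x : Fin (n + 1) → ℝ) (homogenize 4 p)) {0}ᶜ := by
    intro t (ht : t ≠ 0)
    have hlift : liftVec (Fin.cons t x : Fin (n + 1) → ℝ) =
        Sum.elim (fun _ => t ^ 2)
          (Sum.elim (fun a => t * x a) fun pr : PairIdx n => x pr.1.1 * x pr.1.2) := by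
      funext i
      rcases i with _ | _ | _ <;> simp [liftVec, liftIdx, sq]
    have hscale : (fun i => Sum.elim (fun a => t * x a)
          (fun pr : PairIdx n => x pr.1.1 * x pr.1.2) i / t ^ 2) =
        Sum.elim (fun a => x a / t) fun pr : PairIdx n => x pr.1.1 / t * (x pr.1.2 / t) := by
      funext i
      rcases i with _ | _ <;> simp <;> field_simp
    simp only [hlift]
    rw [eval_homogenizeG_of_ne_zero hg (pow_ne_zero 2 ht), eval_homogenize_of_ne_zero hp ht,
      hscale, hgp fun a => x a / t]
    ring
  have hcons : Continuous fun t : ℝ => (Fin.cons t x : Fin (n + 1) → ℝ) := by fun_prop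
  refine congrFun (Continuous.ext_on (dense_compl_singleton (0 : ℝ)) ?_ ?_ hne) t
  · refine (continuous_eval _).comp (continuous_pi fun i => ?_)
    exact ((continuous_apply _).comp hcons).mul ((continuous_apply _).comp hcons)
  · exact (continuous_eval _).comp hcons

theorem IsLinearMap.eqOn_convexHull {E F : Type*} [AddCommGroup E] [Module ℝ E]
    [AddCommGroup F] [Module ℝ F] {f g : E → F} (hf : IsLinearMap ℝ f) (hg : IsLinearMap ℝ g)
    {s : Set E} (hfg : Set.EqOn f g s) : Set.EqOn f g (convexHull ℝ s) := fun _ hx =>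
  LinearMap.eqOn_span (f := hf.mk' f) (g := hg.mk' g) hfg
    (convexHull_min Submodule.subset_span (Submodule.span ℝ s).convex hx)

theorem isLinearMap_tenIP {n d : ℕ} (T : (Fin d → Fin n) → ℝ) : IsLinearMap ℝ (tenIP T) where
  map_add _ _ := by simp [tenIP, mul_add, Finset.sum_add_distrib]
  map_smul _ _ := by simp [tenIP, Finset.mul_sum, mul_left_comm]

theorem isLinearMap_frob {I : Type*} [Fintype I] (Q : Matrix I I ℝ) : IsLinearMap ℝ (frob Q) where
  map_add _ _ := by simp [frob, mul_add, Finset.sum_add_distrib]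
  map_smul _ _ := by simp [frob, Finset.mul_sum, mul_left_comm]

theorem frob_rankOne {I : Type*} [Fintype I] (Q : Matrix I I ℝ) (w : I → ℝ) :
    frob Q (Matrix.of fun i j => w i * w j) = qform Q w := by
  simp only [frob, qform, Matrix.of_apply]
  exact Finset.sum_congr rfl fun i _ => Finset.sum_congr rfl fun j _ => by ring

/-- The cone of completely positive tensors of order 4. -/
def cpTensors (n : ℕ) : Set ((Fin 4 → Fin (n + 1)) → ℝ) :=
  convexHull ℝ {S | ∃ w : Fin (n + 1) → ℝ, (∀ i, 0 ≤ w i) ∧ S = tenM (n + 1) 4 w}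

theorem frob_tensorToMatrix {n : ℕ} {Q : Matrix (QIdx n) (QIdx n) ℝ}
    {T X : (Fin 4 → Fin (n + 1)) → ℝ}
    (hQT : ∀ w, qform Q (liftVec w) = tenIP T (tenM (n + 1) 4 w)) (hX : X ∈ cpTensors n) :
    frob Q (tensorToMatrix n X) = tenIP T X := by
  have hlin : IsLinearMap ℝ fun X => frob Q (tensorToMatrix n X) :=
    ((isLinearMap_frob Q).mk' _ ∘ₗ tensorToMatrix n).isLinear
  refine hlin.eqOn_convexHull (isLinearMap_tenIP T) ?_ hX
  rintro _ ⟨w, -, rfl⟩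
  simp only [tensorToMatrix_tenM, frob_rankOne, hQT]

theorem tensorToMatrix_mem_convexHull {n : ℕ} {X : (Fin 4 → Fin (n + 1)) → ℝ}
    (hX : X ∈ cpTensors n) :
    tensorToMatrix n X ∈ convexHull ℝ {Z : Matrix (QIdx n) (QIdx n) ℝ |
      ∃ w : QIdx n → ℝ, (∀ i, 0 ≤ w i) ∧ Z = Matrix.of fun i j => w i * w j} := by
  have himage := Set.mem_image_of_mem (tensorToMatrix n) hX
  rw [cpTensors, LinearMap.image_convexHull] at himage
  refine convexHull_mono ?_ himage
  rintro _ ⟨_, ⟨w, hw, rfl⟩, rfl⟩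
  exact ⟨liftVec w, fun i => mul_nonneg (hw _) (hw _), tensorToMatrix_tenM w⟩

theorem tensorToMatrix_slot {n : ℕ} {X : (Fin 4 → Fin (n + 1)) → ℝ} (hX : X ∈ cpTensors n)
    (pr : PairIdx n) :
    tensorToMatrix n X (Sum.inl ()) (Sum.inr (Sum.inr pr)) =
      tensorToMatrix n X (Sum.inr (Sum.inl pr.1.1)) (Sum.inr (Sum.inl pr.1.2)) := by
  have hlin (i j : QIdx n) : IsLinearMap ℝ fun X => tensorToMatrix n X i j :=
    ⟨fun _ _ => by simp, fun _ _ => by simp⟩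
  refine (hlin _ _).eqOn_convexHull (hlin _ _) ?_ hX
  rintro _ ⟨w, -, rfl⟩
  simp only [tensorToMatrix_tenM, Matrix.of_apply, liftVec, liftIdx, Sum.elim_inl, Sum.elim_inr]
  ring

/-- every feasible solution of the completely positive tensor relaxation of a
degree-4 POP (with nonnegative objective coefficients) yields a feasible solution of the
completely positive matrix relaxation of its quadratic reformulation with at least the same
objective value; consequently the CP matrix program is a relaxation of the CP tensor
program. -/
theorem cp_matrix_relaxation_of_cp_tensor (n m₀ m₁ : ℕ)
    (p0 : MvPolynomial (Fin n) ℝ)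
    (hp0deg : p0.totalDegree ≤ 4)
    (hp0coeff : ∀ α, 0 ≤ MvPolynomial.coeff α p0)
    (p : Fin m₀ → MvPolynomial (Fin n) ℝ)
    (hphom : ∀ i, (p i).IsHomogeneous 4)
    (q : Fin m₁ → MvPolynomial (Fin n) ℝ)
    (hqdeg : ∀ j, (q j).totalDegree ≤ 2)
    (dvec : Fin m₀ → ℝ)
    (q0 : MvPolynomial (Fin n ⊕ PairIdx n) ℝ)
    (hq0deg : q0.totalDegree ≤ 2)
    (hq0coeff : ∀ α, 0 ≤ MvPolynomial.coeff α q0)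
    (hq0eq : ∀ x : Fin n → ℝ,
      MvPolynomial.eval (Sum.elim x (fun pr => x pr.1.1 * x pr.1.2)) q0 =
        MvPolynomial.eval x p0)
    (h : Fin m₀ → MvPolynomial (PairIdx n) ℝ)
    (hhhom : ∀ i, (h i).IsHomogeneous 2)
    (hheq : ∀ (i : Fin m₀) (x : Fin n → ℝ),
      MvPolynomial.eval (fun pr : PairIdx n => x pr.1.1 * x pr.1.2) (h i) =
        MvPolynomial.eval x (p i))
    -- the symmetric tensors of dimension n+1 and order 4 representing p₀, pᵢ, qⱼ and 1
    (Tp0 : (Fin 4 → Fin (n + 1)) → ℝ) (hTp0symm : IsSymmTensor Tp0)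
    (hTp0rep : Represents 4 Tp0 p0)
    (Tp : Fin m₀ → (Fin 4 → Fin (n + 1)) → ℝ) (hTpsymm : ∀ i, IsSymmTensor (Tp i))
    (hTprep : ∀ i, Represents 4 (Tp i) (p i))
    (Tq : Fin m₁ → (Fin 4 → Fin (n + 1)) → ℝ) (hTqsymm : ∀ j, IsSymmTensor (Tq j))
    (hTqrep : ∀ j, Represents 4 (Tq j) (q j))
    (Te : (Fin 4 → Fin (n + 1)) → ℝ) (hTesymm : IsSymmTensor Te)
    (hTerep : ∀ y : Fin (n + 1) → ℝ, tenIP Te (tenM (n + 1) 4 y) = (y 0) ^ 4)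
    -- the symmetric matrices representing the quadratics q₀, hᵢ, qⱼ and 1 in variables (x,y)
    (Qq0 : Matrix (QIdx n) (QIdx n) ℝ) (hQq0symm : Qq0.IsSymm)
    (hQq0rep : ∀ w : QIdx n → ℝ,
      qform Qq0 w = MvPolynomial.eval w (homogenizeG 2 q0))
    (Qh : Fin m₀ → Matrix (QIdx n) (QIdx n) ℝ) (hQhsymm : ∀ i, (Qh i).IsSymm)
    (hQhrep : ∀ (i : Fin m₀) (w : QIdx n → ℝ),
      qform (Qh i) w =
        MvPolynomial.eval w (homogenizeG 2 (MvPolynomial.rename Sum.inr (h i))))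
    (Qq : Fin m₁ → Matrix (QIdx n) (QIdx n) ℝ) (hQqsymm : ∀ j, (Qq j).IsSymm)
    (hQqrep : ∀ (j : Fin m₁) (w : QIdx n → ℝ),
      qform (Qq j) w =
        MvPolynomial.eval w (homogenizeG 2 (MvPolynomial.rename Sum.inl (q j))))
    (Qe : Matrix (QIdx n) (QIdx n) ℝ) (hQesymm : Qe.IsSymm)
    (hQerep : ∀ w : QIdx n → ℝ, qform Qe w = (w (Sum.inl ())) ^ 2) :
    (∀ X : (Fin 4 → Fin (n + 1)) → ℝ,
      X ∈ convexHull ℝ {S : (Fin 4 → Fin (n + 1)) → ℝ |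
        ∃ w : Fin (n + 1) → ℝ, (∀ i, 0 ≤ w i) ∧ S = tenM (n + 1) 4 w} →
      (∀ i : Fin m₀, tenIP (Tp i) X ≤ dvec i) →
      (∀ j : Fin m₁, tenIP (Tq j) X ≤ 0) →
      tenIP Te X = 1 →
      ∃ Z : Matrix (QIdx n) (QIdx n) ℝ,
        Z ∈ convexHull ℝ {Z' : Matrix (QIdx n) (QIdx n) ℝ |
          ∃ w : QIdx n → ℝ, (∀ i, 0 ≤ w i) ∧ Z' = Matrix.of fun i j => w i * w j} ∧
        (∀ i : Fin m₀, frob (Qh i) Z ≤ dvec i) ∧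
        (∀ j : Fin m₁, frob (Qq j) Z ≤ 0) ∧
        frob Qe Z = 1 ∧
        (∀ pr : PairIdx n,
          Z (Sum.inl ()) (Sum.inr (Sum.inr pr)) ≤
            Z (Sum.inr (Sum.inl pr.1.1)) (Sum.inr (Sum.inl pr.1.2))) ∧
        tenIP Tp0 X ≤ frob Qq0 Z) ∧
    sSup {w : EReal | ∃ X : (Fin 4 → Fin (n + 1)) → ℝ,
        X ∈ convexHull ℝ {S : (Fin 4 → Fin (n + 1)) → ℝ |
          ∃ w' : Fin (n + 1) → ℝ, (∀ i, 0 ≤ w' i) ∧ S = tenM (n + 1) 4 w'} ∧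
        (∀ i : Fin m₀, tenIP (Tp i) X ≤ dvec i) ∧
        (∀ j : Fin m₁, tenIP (Tq j) X ≤ 0) ∧
        tenIP Te X = 1 ∧
        w = ((tenIP Tp0 X : ℝ) : EReal)} ≤
      sSup {w : EReal | ∃ Z : Matrix (QIdx n) (QIdx n) ℝ,
        Z ∈ convexHull ℝ {Z' : Matrix (QIdx n) (QIdx n) ℝ |
          ∃ w' : QIdx n → ℝ, (∀ i, 0 ≤ w' i) ∧ Z' = Matrix.of fun i j => w' i * w' j} ∧
        (∀ i : Fin m₀, frob (Qh i) Z ≤ dvec i) ∧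
        (∀ j : Fin m₁, frob (Qq j) Z ≤ 0) ∧
        frob Qe Z = 1 ∧
        (∀ pr : PairIdx n,
          Z (Sum.inl ()) (Sum.inr (Sum.inr pr)) ≤
            Z (Sum.inr (Sum.inl pr.1.1)) (Sum.inr (Sum.inl pr.1.2))) ∧
        w = ((frob Qq0 Z : ℝ) : EReal)} := by
  have hq0 (w) : qform Qq0 (liftVec w) = tenIP Tp0 (tenM (n + 1) 4 w) := by
    rw [hQq0rep, hTp0rep, eval_liftVec_homogenizeG hq0deg hp0deg hq0eq]
  have hh (i) (w) : qform (Qh i) (liftVec w) = tenIP (Tp i) (tenM (n + 1) 4 w) := by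
    rw [hQhrep, hTprep]
    refine eval_liftVec_homogenizeG
      ((MvPolynomial.totalDegree_rename_le _ _).trans (hhhom i).totalDegree_le)
      (hphom i).totalDegree_le (fun x => ?_) w
    rw [MvPolynomial.eval_rename, ← hheq, Sum.elim_comp_inr]
  have hq (j) (w) : qform (Qq j) (liftVec w) = tenIP (Tq j) (tenM (n + 1) 4 w) := by
    rw [hQqrep, hTqrep]
    refine eval_liftVec_homogenizeG
      ((MvPolynomial.totalDegree_rename_le _ _).trans (hqdeg j))
      ((hqdeg j).trans (by norm_num)) (fun x => ?_) w
    rw [MvPolynomial.eval_rename, Sum.elim_comp_inl]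
  have he (w) : qform Qe (liftVec w) = tenIP Te (tenM (n + 1) 4 w) := by
    rw [hQerep, hTerep, liftVec, liftIdx, Sum.elim_inl]
    ring
  refine (and_iff_left_of_imp fun hfeas => ?_).2 fun X hX hXp hXq hXe =>
    ⟨tensorToMatrix n X, tensorToMatrix_mem_convexHull hX,
      fun i => (frob_tensorToMatrix (hh i) hX).trans_le (hXp i),
      fun j => (frob_tensorToMatrix (hq j) hX).trans_le (hXq j),
      (frob_tensorToMatrix he hX).trans hXe,
      fun pr => (tensorToMatrix_slot hX pr).le,
      (frob_tensorToMatrix hq0 hX).ge⟩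
  refine sSup_le ?_
  rintro _ ⟨X, hX, hXp, hXq, hXe, rfl⟩
  obtain ⟨Z, hZ, hZh, hZq, hZe, hZslot, hle⟩ := hfeas X hX hXp hXq hXe
  exact (EReal.coe_le_coe_iff.2 hle).trans (le_sSup ⟨Z, hZ, hZh, hZq, hZe, hZslot, rfl⟩)
end

section
/- Let d ≥ 1 and let T be a tensor of dimension n and order 2d belonging to the completely positive semidefinite tensor cone convexHull{M_{2d}(x) : x ∈ ℝⁿ}. Then for every tuple (i₁,…,i_{2d−2}) of indices in Fin n in which every element of Fin n occurs an even number of times (such a slice is called a principal matrix), the n×n matrix whose (j,k) entry is T(i₁,…,i_{2d−2},j,k) is positive semidefinite. -/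
/-- A product of real numbers along a family in which every index occurs an even number of times
is nonnegative. -/
theorem prod_comp_nonneg_of_even_card_fiber {ι κ : Type*} [Fintype ι] [Fintype κ]
    [DecidableEq κ] (x : κ → ℝ) (g : ι → κ)
    (hg : ∀ k, Even (Finset.univ.filter (fun j => g j = k)).card) :
    0 ≤ ∏ j, x (g j) := by
  rw [← Finset.prod_fiberwise' Finset.univ g x]
  refine Finset.prod_nonneg fun k _ => ?_
  rw [Finset.prod_const]
  exact (hg k).pow_nonneg _

/-- The tensors with a positive semidefinite slice at `g` form a convex set. -/
theorem convex_setOf_posSemidef_slice {n m : ℕ} (g : Fin m → Fin n) :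
    Convex ℝ {S : (Fin (m + 2) → Fin n) → ℝ |
      Matrix.PosSemidef (Matrix.of fun j k : Fin n => S (Fin.append g ![j, k]))} := by
  intro S hS R hR a b ha hb _
  exact (Matrix.PosSemidef.smul hS ha).add (Matrix.PosSemidef.smul hR hb)

/-- A slice of `M_{m+2}(x)` is a multiple of the rank-one matrix `x xᵀ`. -/
theorem tenM_append_pair {n m : ℕ} (x : Fin n → ℝ) (g : Fin m → Fin n) (j k : Fin n) :
    tenM n (m + 2) x (Fin.append g ![j, k]) = (∏ i, x (g i)) * (x j * x k) := by
  simp [tenM, Fin.prod_univ_add]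

/-- for order `2d = 2e + 2` with `d = e + 1 ≥ 1`, every tensor `T` in the
completely positive semidefinite tensor cone has every *principal* matrix slice
`(j, k) ↦ T(i₁, …, i_{2d-2}, j, k)` (i.e. every index of `Fin n` occurs an even number of
times among `i₁, …, i_{2d-2}`) positive semidefinite. -/
theorem cpsd_tensor_principal_slices_psd (n e : ℕ)
    (T : (Fin (2 * e + 2) → Fin n) → ℝ)
    (hT : T ∈ convexHull ℝ {S : (Fin (2 * e + 2) → Fin n) → ℝ |
      ∃ x : Fin n → ℝ, S = tenM n (2 * e + 2) x}) :
    ∀ g : Fin (2 * e) → Fin n,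
      (∀ k : Fin n, Even (Finset.univ.filter (fun j : Fin (2 * e) => g j = k)).card) →
      Matrix.PosSemidef (Matrix.of fun j k : Fin n => T (Fin.append g ![j, k])) := by
  intro g hg
  refine convexHull_min ?_ (convex_setOf_posSemidef_slice g) hT
  rintro _ ⟨x, rfl⟩
  have hslice : (Matrix.of fun j k : Fin n => tenM n (2 * e + 2) x (Fin.append g ![j, k])) =
      (∏ i, x (g i)) • Matrix.vecMulVec x (star x) := by
    ext j k
    simp [tenM_append_pair, Matrix.vecMulVec_apply]
  rw [Set.mem_ofPred_eq, hslice]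
  exact (Matrix.posSemidef_vecMulVec_self_star x).smul
    (prod_comp_nonneg_of_even_card_fiber x g hg)
end

section
/- Let n ≥ 2 and m ≥ 2, let P_n = {(i,j) : 1 ≤ i < j ≤ n} and P_m = {(a,b) : 1 ≤ a < b ≤ m}, and let N = n + m + |P_n| + |P_m|, with coordinates of ℝ^N indexed by the disjoint union {1,…,n} (x-block) ⊔ {1,…,m} (y-block) ⊔ P_n (w-block) ⊔ P_m (z-block). Consider pairs (u, Q) with u ∈ ℝ^N and Q a symmetric N×N real matrix satisfying: (i) the (N+1)×(N+1) block matrix [[1, uᵀ],[u, Q]] is positive semidefinite; (ii) u_{w(i,j)} = Q_{x(i), x(j)} for every (i,j) ∈ P_n; (iii) u_{z(a,b)} = Q_{y(a), y(b)} for every (a,b) ∈ P_m; (iv) ∑_{i=1}^n Q_{x(i), x(i)} = 1; (v) ∑_{a=1}^m Q_{y(a), y(a)} = 1. Then the objective function (u,Q) ↦ ∑_{(i,j) ∈ P_n} ∑_{(a,b) ∈ P_m} Q_{w(i,j), z(a,b)} is unbounded below on this feasible set: for every c ∈ ℝ there exists a feasible pair (u, Q) whose objective value is less than c. -/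
/-- The index set `{(i,j) : 1 ≤ i < j ≤ n}` of pairs. -/
abbrev PairLt (n : ℕ) : Type := {q : Fin n × Fin n // q.1 < q.2}

/-- Coordinates of `ℝ^N` with `N = n + m + |P_n| + |P_m|`: the `x`-block, the `y`-block,
the `w`-block (indexed by `P_n`) and the `z`-block (indexed by `P_m`). -/
abbrev BIdx (n m : ℕ) : Type := (Fin n ⊕ Fin m) ⊕ (PairLt n ⊕ PairLt m)

/-- The rank-two moment matrix `(1, u)(1, u)ᵀ + (0, v)(0, v)ᵀ` is positive semidefinite. -/
theorem posSemidef_fromBlocks_one_vecMulVec_add {ι : Type*} [Finite ι] (u v : ι → ℝ) :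
    (Matrix.fromBlocks
      (Matrix.of fun _ _ : Unit => (1 : ℝ))
      (Matrix.of fun (_ : Unit) j => u j)
      (Matrix.of fun i (_ : Unit) => u i)
      (Matrix.vecMulVec u u + Matrix.vecMulVec v v)).PosSemidef := by
  have := Fintype.ofFinite ι
  convert (Matrix.posSemidef_vecMulVec_self_star (Sum.elim (fun _ : Unit => (1 : ℝ)) u)).add
    (Matrix.posSemidef_vecMulVec_self_star (Sum.elim (fun _ : Unit => (0 : ℝ)) v)) using 1
  ext (i | i) (j | j) <;> simp [Matrix.vecMulVec_apply]

theorem one_le_card_pairLt {n : ℕ} (hn : 2 ≤ n) : 1 ≤ Fintype.card (PairLt n) :=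
  Fintype.card_pos_iff.mpr ⟨⟨(⟨0, by omega⟩, ⟨1, by omega⟩), by simp [Fin.lt_def]⟩⟩

/-- the SDP relaxation of the quadratic reformulation of the bi-quadratic
problem is unbounded below: for every `c ∈ ℝ` there is a feasible pair `(u, Q)` whose
objective value `∑_{(i,j) ∈ P_n} ∑_{(a,b) ∈ P_m} Q_{w(i,j), z(a,b)}` is less than `c`. -/
theorem biquadratic_sdp_relaxation_unbounded (n m : ℕ) (hn : 2 ≤ n) (hm : 2 ≤ m) :
    ∀ c : ℝ, ∃ (u : BIdx n m → ℝ) (Q : Matrix (BIdx n m) (BIdx n m) ℝ),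
      Q.IsSymm ∧
      (Matrix.fromBlocks
        (Matrix.of fun _ _ : Unit => (1 : ℝ))
        (Matrix.of fun (_ : Unit) j => u j)
        (Matrix.of fun i (_ : Unit) => u i)
        Q).PosSemidef ∧
      (∀ q : PairLt n,
        u (Sum.inr (Sum.inl q)) = Q (Sum.inl (Sum.inl q.1.1)) (Sum.inl (Sum.inl q.1.2))) ∧
      (∀ q : PairLt m,
        u (Sum.inr (Sum.inr q)) = Q (Sum.inl (Sum.inr q.1.1)) (Sum.inl (Sum.inr q.1.2))) ∧
      (∑ i : Fin n, Q (Sum.inl (Sum.inl i)) (Sum.inl (Sum.inl i)) = 1) ∧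
      (∑ a : Fin m, Q (Sum.inl (Sum.inr a)) (Sum.inl (Sum.inr a)) = 1) ∧
      (∑ q : PairLt n, ∑ q' : PairLt m, Q (Sum.inr (Sum.inl q)) (Sum.inr (Sum.inr q')) < c) := by
  intro c
  let s : ℝ := |c| + 1
  let u : BIdx n m → ℝ := Sum.elim
    (Sum.elim (Pi.single ⟨0, by omega⟩ 1) (Pi.single ⟨0, by omega⟩ 1)) 0
  let v : BIdx n m → ℝ := Sum.elim 0 (Sum.elim (fun _ => s) (fun _ => -s))
  refine ⟨u, Matrix.vecMulVec u u + Matrix.vecMulVec v v, ?_, ?_, ?_, ?_, ?_, ?_, ?_⟩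
  · simp [Matrix.IsSymm, Matrix.transpose_add, Matrix.transpose_vecMulVec]
  · exact posSemidef_fromBlocks_one_vecMulVec_add u v
  · rintro ⟨⟨i, j⟩, hij⟩
    have hj : j ≠ ⟨0, by omega⟩ := fun h => by simp [h, Fin.lt_def] at hij
    simp [u, v, Matrix.vecMulVec_apply, Pi.single_eq_of_ne hj]
  · rintro ⟨⟨a, b⟩, hab⟩
    have hb : b ≠ ⟨0, by omega⟩ := fun h => by simp [h, Fin.lt_def] at hab
    simp [u, v, Matrix.vecMulVec_apply, Pi.single_eq_of_ne hb]
  · simp [u, v, Matrix.vecMulVec_apply, Pi.single_apply]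
  · simp [u, v, Matrix.vecMulVec_apply, Pi.single_apply]
  · have hP := one_le_card_pairLt hn
    have hP' := one_le_card_pairLt hm
    have hPP : (1 : ℝ) ≤ Fintype.card (PairLt n) * Fintype.card (PairLt m) := by
      exact_mod_cast Nat.mul_le_mul hP hP'
    calc _ = -((Fintype.card (PairLt n) * Fintype.card (PairLt m) : ℝ) * (s * s)) := by
          simp [u, v, Matrix.vecMulVec_apply, mul_assoc]
      _ ≤ -(s * s) := neg_le_neg (le_mul_of_one_le_left (mul_self_nonneg s) hPP)
      _ < c := by
          have hc := neg_abs_le c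
          have h0 := abs_nonneg c
          simp only [s]
          nlinarith
end
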